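/- arXiv:2605.12085 — 3 statements merged into one kernel-verified Lean document; each statement's English description precedes it below -/
import Mathlib

section
/- Let d ≥ 1, let f : ℝ^d → ℝ be differentiable with L-Lipschitz continuous gradient for some L > 0, and let R : ℝ^d → ℝ be convex. Let x, g ∈ ℝ^d, let 0 < α ≤ 1/(2L), and let x⁺ ∈ ℝ^d be a minimizer over ℝ^d of z ↦ R(z) + (1/(2α))‖z − (x − αg)‖². Then f(x⁺) + R(x⁺) ≤ f(x) + R(x) − (1/(4α))‖x⁺ − x‖² + (α/2)‖∇f(x) − g‖². -/
open scoped RealInnerProductSpace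

/-- The descent lemma: a function with `L`-Lipschitz gradient lies below its quadratic model. -/
theorem le_add_inner_gradient_add_sq {E : Type*} [NormedAddCommGroup E] [InnerProductSpace ℝ E]
    [CompleteSpace E] {f : E → ℝ} {L : ℝ} (hf : Differentiable ℝ f)
    (hlip : ∀ u v, ‖gradient f u - gradient f v‖ ≤ L * ‖u - v‖) (x p : E) :
    f (x + p) ≤ f x + ⟪gradient f x, p⟫ + L / 2 * ‖p‖ ^ 2 := by
  have hline (t : ℝ) : HasDerivAt (fun s : ℝ => f (x + s • p)) ⟪gradient f (x + t • p), p⟫ t := by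
    have hp : HasDerivAt (fun s : ℝ => x + s • p) p t := by
      simpa using ((hasDerivAt_id t).smul_const p).const_add x
    exact (hf (x + t • p)).hasGradientAt.hasFDerivAt.comp_hasDerivAt t hp
  have hmodel (t : ℝ) : HasDerivAt
      (fun s : ℝ => f x + s * ⟪gradient f x, p⟫ + L / 2 * ‖p‖ ^ 2 * s ^ 2)
      (⟪gradient f x, p⟫ + L * ‖p‖ ^ 2 * t) t := by
    refine ((((hasDerivAt_id t).mul_const ⟪gradient f x, p⟫).const_add (f x)).add
      ((hasDerivAt_pow 2 t).const_mul (L / 2 * ‖p‖ ^ 2))).congr_deriv ?_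
    push_cast
    ring
  have hbound : ∀ t ∈ Set.Ico (0 : ℝ) 1,
      ⟪gradient f (x + t • p), p⟫ ≤ ⟪gradient f x, p⟫ + L * ‖p‖ ^ 2 * t := by
    intro t ht
    have hle : ⟪gradient f (x + t • p) - gradient f x, p⟫ ≤ L * ‖p‖ ^ 2 * t := calc
      _ ≤ ‖gradient f (x + t • p) - gradient f x‖ * ‖p‖ := real_inner_le_norm _ _
      _ ≤ L * ‖x + t • p - x‖ * ‖p‖ := by gcongr; exact hlip _ _
      _ = L * ‖p‖ ^ 2 * t := by
        rw [add_sub_cancel_left, norm_smul, Real.norm_of_nonneg ht.1]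
        ring
    rw [inner_sub_left] at hle
    linarith
  simpa using image_le_of_deriv_right_le_deriv_boundary
    (fun t _ => (hline t).continuousAt.continuousWithinAt)
    (fun t _ => (hline t).hasDerivWithinAt) (by simp)
    (fun t _ => (hmodel t).continuousAt.continuousWithinAt)
    (fun t _ => (hmodel t).hasDerivWithinAt) hbound (Set.right_mem_Icc.2 zero_le_one)

/-- The variational inequality satisfied by a proximal point `y` of `w`. -/
theorem ConvexOn.add_inner_le_of_forall_prox_le {E : Type*} [NormedAddCommGroup E]
    [InnerProductSpace ℝ E] {R : E → ℝ} (hR : ConvexOn ℝ Set.univ R) {c : ℝ} {y w : E}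
    (hmin : ∀ z, R y + c * ‖y - w‖ ^ 2 ≤ R z + c * ‖z - w‖ ^ 2) (x : E) :
    R y + 2 * c * ⟪y - w, y - x⟫ ≤ R x := by
  have hstep : ∀ t ∈ Set.Ioo (0 : ℝ) 1,
      R y + 2 * c * ⟪y - w, y - x⟫ ≤ R x + t * (c * ‖y - x‖ ^ 2) := by
    intro t ht
    have hconv := hR.2 (Set.mem_univ y) (Set.mem_univ x) (sub_nonneg.2 ht.2.le) ht.1.le
      (sub_add_cancel 1 t)
    have hz := hmin ((1 - t) • y + t • x)
    have hnorm : ‖(1 - t) • y + t • x - w‖ ^ 2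
        = ‖y - w‖ ^ 2 - 2 * t * ⟪y - w, y - x⟫ + t ^ 2 * ‖y - x‖ ^ 2 := by
      rw [show (1 - t) • y + t • x - w = (y - w) - t • (y - x) by module, norm_sub_sq_real,
        real_inner_smul_right, norm_smul, mul_pow, Real.norm_eq_abs, sq_abs]
      ring
    rw [hnorm] at hz
    simp only [smul_eq_mul] at hconv
    refine le_of_mul_le_mul_left ?_ ht.1
    linarith
  have hlim : Filter.Tendsto (fun t : ℝ => R x + t * (c * ‖y - x‖ ^ 2))
      (nhdsWithin 0 (Set.Ioi 0)) (nhds (R x)) := by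
    have hcont : Continuous fun t : ℝ => R x + t * (c * ‖y - x‖ ^ 2) := by fun_prop
    simpa using (hcont.tendsto 0).mono_left nhdsWithin_le_nhds
  exact ge_of_tendsto hlim
    (Filter.mem_of_superset (Ioo_mem_nhdsGT zero_lt_one) hstep)

/-- Per-iteration sufficient-decrease inequality with inexact gradient (A4):
for one forward–backward step `x⁺ = prox_{αR}(x − αg)` with `0 < α ≤ 1/(2L)`,
`f(x⁺) + R(x⁺) ≤ f(x) + R(x) − (1/(4α))‖x⁺ − x‖² + (α/2)‖∇f(x) − g‖²`. -/
theorem stmt3 {d : ℕ} (hd : 1 ≤ d)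
    (f R : EuclideanSpace ℝ (Fin d) → ℝ) (L : ℝ) (hL : 0 < L)
    (hf : Differentiable ℝ f)
    (hlip : ∀ u v, ‖gradient f u - gradient f v‖ ≤ L * ‖u - v‖)
    (hR : ConvexOn ℝ Set.univ R)
    (x g xplus : EuclideanSpace ℝ (Fin d)) (α : ℝ)
    (hα : 0 < α) (hαle : α ≤ 1 / (2 * L))
    (hmin : ∀ z, R xplus + (1 / (2 * α)) * ‖xplus - (x - α • g)‖ ^ 2
        ≤ R z + (1 / (2 * α)) * ‖z - (x - α • g)‖ ^ 2) :
    f xplus + R xplus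
      ≤ f x + R x - (1 / (4 * α)) * ‖xplus - x‖ ^ 2 + (α / 2) * ‖gradient f x - g‖ ^ 2 := by
  have hdescent := le_add_inner_gradient_add_sq hf hlip x (xplus - x)
  have hprox := hR.add_inner_le_of_forall_prox_le hmin x
  rw [add_sub_cancel] at hdescent
  rw [show xplus - (x - α • g) = (xplus - x) + α • g by module, inner_add_left,
    real_inner_self_eq_norm_sq, real_inner_smul_left] at hprox
  set p := xplus - x
  have hyoung : ⟪gradient f x - g, p⟫
      ≤ α / 2 * ‖gradient f x - g‖ ^ 2 + 1 / (2 * α) * ‖p‖ ^ 2 := by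
    have hsq := sq_nonneg (α * ‖gradient f x - g‖ - ‖p‖)
    refine (real_inner_le_norm _ _).trans (sub_nonneg.1 ?_)
    have hdiv := div_nonneg hsq (by positivity : 0 ≤ 2 * α)
    convert hdiv using 1
    field_simp
    ring
  rw [inner_sub_left] at hyoung
  have hL' : L / 2 ≤ 1 / (4 * α) := by
    rw [le_div_iff₀ (by positivity)] at hαle ⊢
    linarith
  have hquad := mul_le_mul_of_nonneg_right hL' (sq_nonneg ‖p‖)
  have hprox' : 2 * (1 / (2 * α)) * (‖p‖ ^ 2 + α * ⟪g, p⟫)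
      = 4 * (1 / (4 * α) * ‖p‖ ^ 2) + ⟪g, p⟫ := by
    field_simp
  have hhalf : 1 / (2 * α) * ‖p‖ ^ 2 = 2 * (1 / (4 * α) * ‖p‖ ^ 2) := by
    field_simp
    ring
  linarith
end

section
/- Let d ≥ 1, let f : ℝ^d → ℝ be differentiable with L-Lipschitz continuous gradient for some L > 0, and let R : ℝ^d → ℝ be convex. Let 0 < α̃ ≤ α ≤ α_max ≤ 1/(2L), and let x, g ∈ ℝ^d. Let x⁺ ∈ ℝ^d be a minimizer over ℝ^d of z ↦ R(z) + (1/(2α))‖z − (x − αg)‖², and let p ∈ ℝ^d be a minimizer over ℝ^d of z ↦ R(z) + (1/(2α))‖z − (x − α∇f(x))‖². Then f(x⁺) + R(x⁺) ≤ f(x) + R(x) − (α̃/(8α²))‖x − p‖² + (3α_max/4)‖∇f(x) − g‖². -/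
open scoped RealInnerProductSpace

section

variable {E : Type*} [NormedAddCommGroup E] [InnerProductSpace ℝ E]

/-- Quadratic growth of `z ↦ R z + c * ‖z - w‖ ^ 2` around its minimizer, for convex `R`. -/
theorem ConvexOn.add_mul_norm_sq_le_of_isMin {R : E → ℝ} (hR : ConvexOn ℝ Set.univ R)
    {c : ℝ} {w q : E} (hq : ∀ z, R q + c * ‖q - w‖ ^ 2 ≤ R z + c * ‖z - w‖ ^ 2) (z : E) :
    R q + c * ‖q - w‖ ^ 2 + c * ‖z - q‖ ^ 2 ≤ R z + c * ‖z - w‖ ^ 2 := by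
  have key : ∀ t : ℝ, 0 < t → t < 1 →
      R q + c * ‖q - w‖ ^ 2 + c * (1 - t) * ‖z - q‖ ^ 2 ≤ R z + c * ‖z - w‖ ^ 2 := by
    intro t ht ht1
    have hconv := hR.2 (Set.mem_univ q) (Set.mem_univ z) (sub_nonneg.2 ht1.le) ht.le
      (sub_add_cancel 1 t)
    have hmin := hq ((1 - t) • q + t • z)
    have e1 : (1 - t) • q + t • z - w = (q - w) + t • (z - q) := by module
    have e2 : z - w = (q - w) + (z - q) := by abel
    rw [e1, norm_add_sq_real, norm_smul, inner_smul_right, mul_pow, Real.norm_eq_abs,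
      sq_abs] at hmin
    rw [e2, norm_add_sq_real]
    simp only [smul_eq_mul] at hconv
    refine le_of_mul_le_mul_left ?_ ht
    linear_combination hmin + hconv
  have hlim : Filter.Tendsto
      (fun t : ℝ => R q + c * ‖q - w‖ ^ 2 + c * (1 - t) * ‖z - q‖ ^ 2)
      (nhdsWithin 0 (Set.Ioi 0)) (nhds (R q + c * ‖q - w‖ ^ 2 + c * (1 - 0) * ‖z - q‖ ^ 2)) :=
    Filter.Tendsto.mono_left (Continuous.tendsto (by fun_prop) 0) nhdsWithin_le_nhds
  rw [sub_zero, mul_one] at hlim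
  refine le_of_tendsto hlim ?_
  filter_upwards [Ioo_mem_nhdsGT (zero_lt_one' ℝ)] with t ht using key t ht.1 ht.2

/-- Proximal inequality for a proximal-gradient step `q` from `x` along `-v`. -/
theorem ConvexOn.prox_step_le {R : E → ℝ} (hR : ConvexOn ℝ Set.univ R) {α : ℝ} (hα : 0 < α)
    {x v q : E} (hq : ∀ z, R q + (1 / (2 * α)) * ‖q - (x - α • v)‖ ^ 2
      ≤ R z + (1 / (2 * α)) * ‖z - (x - α • v)‖ ^ 2) (z : E) :
    R q + ⟪v, q - z⟫ + (1 / (2 * α)) * (‖q - x‖ ^ 2 + ‖z - q‖ ^ 2 - ‖z - x‖ ^ 2) ≤ R z := by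
  have h := hR.add_mul_norm_sq_le_of_isMin hq z
  have expand : ∀ y : E, ‖y - (x - α • v)‖ ^ 2
      = ‖y - x‖ ^ 2 + 2 * (α * ⟪v, y - x⟫) + ‖α • v‖ ^ 2 := by
    intro y
    rw [show y - (x - α • v) = (y - x) + α • v by abel, norm_add_sq_real, inner_smul_right,
      real_inner_comm]
  rw [expand, expand] at h
  have hin : ⟪v, q - z⟫ = ⟪v, q - x⟫ - ⟪v, z - x⟫ := by
    rw [← inner_sub_right]; congr 1; abel
  have hc : 1 / (2 * α) * (2 * α) = 1 := by field_simp
  rw [hin]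
  linear_combination h - hc * (⟪v, q - x⟫ - ⟪v, z - x⟫)

/-- The descent lemma for a function with Lipschitz gradient. -/
theorem le_add_inner_gradient_add_norm_sq [CompleteSpace E] {f : E → ℝ} {L : ℝ}
    (hf : Differentiable ℝ f)
    (hlip : ∀ u v, ‖gradient f u - gradient f v‖ ≤ L * ‖u - v‖) (x y : E) :
    f y ≤ f x + ⟪gradient f x, y - x⟫ + L / 2 * ‖y - x‖ ^ 2 := by
  set a := y - x with ha
  let φ : ℝ → ℝ := fun t => f (x + t • a) - t * ⟪gradient f x, a⟫ - L / 2 * ‖a‖ ^ 2 * t ^ 2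
  have hφ : ∀ t, HasDerivAt φ
      (⟪gradient f (x + t • a), a⟫ - ⟪gradient f x, a⟫ - L * ‖a‖ ^ 2 * t) t := by
    intro t
    have hline : HasDerivAt (fun s : ℝ => x + s • a) a t := by
      simpa using ((hasDerivAt_id t).smul_const a).const_add x
    have hcomp := (hf (x + t • a)).hasGradientAt.hasFDerivAt.comp_hasDerivAt t hline
    rw [InnerProductSpace.toDual_apply_apply] at hcomp
    have hlin : HasDerivAt (fun s : ℝ => s * ⟪gradient f x, a⟫) ⟪gradient f x, a⟫ t := by
      simpa using (hasDerivAt_id t).mul_const ⟪gradient f x, a⟫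
    have hsq := (hasDerivAt_pow 2 t).const_mul (L / 2 * ‖a‖ ^ 2)
    refine ((hcomp.sub hlin).sub hsq).congr_deriv ?_
    push_cast
    ring
  have hanti : AntitoneOn φ (Set.Ici 0) := by
    refine antitoneOn_of_deriv_nonpos (convex_Ici 0)
      (fun t _ => (hφ t).continuousAt.continuousWithinAt)
      (fun t _ => (hφ t).differentiableAt.differentiableWithinAt) ?_
    intro t ht
    rw [interior_Ici, Set.mem_Ioi] at ht
    rw [(hφ t).deriv, ← inner_sub_left]
    have hcs := real_inner_le_norm (gradient f (x + t • a) - gradient f x) a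
    have hg := hlip (x + t • a) x
    rw [add_sub_cancel_left, norm_smul, Real.norm_of_nonneg ht.le] at hg
    have := mul_le_mul_of_nonneg_right hg (norm_nonneg a)
    linear_combination hcs + this
  have h01 := hanti (Set.mem_Ici.2 le_rfl) (Set.mem_Ici.2 zero_le_one) zero_le_one
  simp only [φ, zero_smul, one_smul, add_zero, zero_mul, one_mul] at h01
  rw [ha, add_sub_cancel, ← ha] at h01
  linear_combination h01

end


/-- Key per-iteration inequality of the FB–LISA analysis: with
`x⁺ = prox_{αR}(x − αg)` and `p = prox_{αR}(x − α∇f(x))`, `0 < α̃ ≤ α ≤ α_max ≤ 1/(2L)`,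
`f(x⁺)+R(x⁺) ≤ f(x)+R(x) − (α̃/(8α²))‖x − p‖² + (3α_max/4)‖∇f(x) − g‖²`. -/
theorem stmt5 {d : ℕ} (hd : 1 ≤ d)
    (f R : EuclideanSpace ℝ (Fin d) → ℝ) (L : ℝ) (hL : 0 < L)
    (hf : Differentiable ℝ f)
    (hlip : ∀ u v, ‖gradient f u - gradient f v‖ ≤ L * ‖u - v‖)
    (hR : ConvexOn ℝ Set.univ R)
    (αtil α αmax : ℝ) (hαtil : 0 < αtil) (h1 : αtil ≤ α) (h2 : α ≤ αmax)
    (h3 : αmax ≤ 1 / (2 * L))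
    (x g xplus p : EuclideanSpace ℝ (Fin d))
    (hmin : ∀ z, R xplus + (1 / (2 * α)) * ‖xplus - (x - α • g)‖ ^ 2
        ≤ R z + (1 / (2 * α)) * ‖z - (x - α • g)‖ ^ 2)
    (hp : ∀ z, R p + (1 / (2 * α)) * ‖p - (x - α • gradient f x)‖ ^ 2
        ≤ R z + (1 / (2 * α)) * ‖z - (x - α • gradient f x)‖ ^ 2) :
    f xplus + R xplus
      ≤ f x + R x - (αtil / (8 * α ^ 2)) * ‖x - p‖ ^ 2
          + (3 * αmax / 4) * ‖gradient f x - g‖ ^ 2 := by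
  have hα : 0 < α := hαtil.trans_le h1
  set c := 1 / (2 * α) with hc
  have hcpos : 0 < c := by positivity
  have hcα : c * α = 1 / 2 := by rw [hc]; field_simp
  have hLc : L ≤ c := by
    rw [hc, le_div_iff₀ (by positivity)]
    have := (le_div_iff₀ (by positivity)).1 (h2.trans h3)
    linarith
  have hdesc := le_add_inner_gradient_add_norm_sq hf hlip x xplus
  have hstep := hR.prox_step_le hα hmin x
  have hstep₁ := hR.prox_step_le hα hmin p
  have hstep₂ := hR.prox_step_le hα hp xplus
  rw [← hc] at hstep hstep₁ hstep₂
  set e := gradient f x - g with he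
  have hgrad : gradient f x = g + e := by rw [he]; abel
  rw [hgrad, inner_add_left] at hdesc hstep₂
  rw [norm_sub_rev x xplus, sub_self, norm_zero] at hstep
  have hflip : ⟪g, xplus - p⟫ = -⟪g, p - xplus⟫ := by rw [← inner_neg_right, neg_sub]
  rw [hflip, norm_sub_rev p xplus] at hstep₁
  have hcs := neg_le_of_abs_le (abs_real_inner_le_norm e (p - xplus))
  rw [norm_sub_rev p xplus] at hcs
  have hcs' := real_inner_le_norm e (xplus - x)
  set r := ‖xplus - p‖
  set a := ‖xplus - x‖
  have hr0 : 0 ≤ r := norm_nonneg _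
  have hr : r ≤ α * ‖e‖ := by
    rcases hr0.eq_or_lt with h0 | hpos
    · rw [← h0]; positivity
    · have hmul : 2 * c * r * r ≤ ‖e‖ * r := by linarith
      have := mul_le_mul_of_nonneg_left (le_of_mul_le_mul_right hmul hpos) hα.le
      linear_combination this - 2 * r * hcα
  have htri : ‖x - p‖ ≤ a + r := by
    have := norm_sub_le_norm_sub_add_norm_sub x xplus p
    rwa [norm_sub_rev x xplus] at this
  have hxp : ‖x - p‖ ^ 2 ≤ 2 * a ^ 2 + 2 * (α * ‖e‖) ^ 2 := by
    have h := pow_le_pow_left₀ (norm_nonneg _) (htri.trans (add_le_add_right hr a)) 2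
    linarith [sq_nonneg (a - α * ‖e‖)]
  have hcoef : αtil / (8 * α ^ 2) ≤ c / 4 := by
    rw [div_le_iff₀ (by positivity)]
    linear_combination h1 - 2 * α * hcα
  have hdecr := (mul_le_mul_of_nonneg_right hcoef (sq_nonneg ‖x - p‖)).trans
    (mul_le_mul_of_nonneg_left hxp (by positivity))
  have hLa := mul_le_mul_of_nonneg_right hLc (sq_nonneg a)
  have hE := mul_le_mul_of_nonneg_right h2 (sq_nonneg ‖e‖)
  have hyoung := mul_nonneg hcpos.le (sq_nonneg (a - α * ‖e‖))
  linear_combination hdesc + hstep + hcs' + hdecr + hLa / 2 + 3 / 4 * hE + hyoung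
    + (3 / 2 * α * ‖e‖ ^ 2 - 2 * a * ‖e‖) * hcα
end

section
/- Let d ≥ 1, let f : ℝ^d → ℝ be differentiable with L-Lipschitz continuous gradient for some L > 0, let R : ℝ^d → ℝ be convex, and suppose F = f + R is bounded below by F_inf ∈ ℝ. Let 0 < α̃ ≤ α_max ≤ 1/(2L) and let (x_k)_{k∈ℕ} in ℝ^d, (g_k)_{k∈ℕ} in ℝ^d, and (α_k)_{k∈ℕ} in [α̃, α_max] be sequences such that for every k, x_{k+1} is a minimizer over ℝ^d of z ↦ R(z) + (1/(2α_k))‖z − (x_k − α_k g_k)‖². Suppose there is a sequence (ε_k) of nonnegative reals with ‖∇f(x_k) − g_k‖² ≤ ε_k for all k and ∑_{k=0}^∞ ε_k = ε̄ < ∞. For each k let p_k be a minimizer over ℝ^d of z ↦ R(z) + (1/(2α_k))‖z − (x_k − α_k ∇f(x_k))‖². Then ∑_{k=0}^∞ (1/α_k²)‖x_k − p_k‖² ≤ (8(f(x_0) + R(x_0) − F_inf) + 6 α_max ε̄)/α̃; in particular the series converges and (1/α_k)‖x_k − p_k‖ → 0 as k → ∞. -/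
open Filter

section ProximalPoint

variable {E : Type*} [NormedAddCommGroup E] [InnerProductSpace ℝ E]

/-- The variational inequality characterizing a proximal point of a convex function. -/
theorem ConvexOn.prox_variational_inequality {R : E → ℝ} (hR : ConvexOn ℝ Set.univ R)
    {a : ℝ} (ha : 0 < a) {q w : E}
    (hq : ∀ z, R q + (1 / (2 * a)) * ‖q - w‖ ^ 2 ≤ R z + (1 / (2 * a)) * ‖z - w‖ ^ 2) (z : E) :
    0 ≤ a * (R z - R q) + inner ℝ (q - w) (z - q) := by
  have key : ∀ t : ℝ, 0 < t → t < 1 →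
      0 ≤ a * (R z - R q) + inner ℝ (q - w) (z - q) + t * (‖z - q‖ ^ 2 / 2) := by
    intro t ht ht1
    have h1 := hq (q + t • (z - q))
    have h2 := hR.2 (Set.mem_univ q) (Set.mem_univ z) (sub_nonneg.2 ht1.le) ht.le (by ring)
    rw [show (1 - t) • q + t • z = q + t • (z - q) by module] at h2
    rw [show q + t • (z - q) - w = (q - w) + t • (z - q) by module, norm_add_sq_real,
      inner_smul_right, norm_smul, mul_pow, Real.norm_eq_abs, sq_abs] at h1
    simp only [smul_eq_mul] at h2
    have h3 : 0 ≤ t * (R z - R q) +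
        (1 / (2 * a)) * (2 * (t * inner ℝ (q - w) (z - q)) + t ^ 2 * ‖z - q‖ ^ 2) := by
      linarith
    have h4 := mul_nonneg ha.le h3
    have h5 : a * (t * (R z - R q) +
        (1 / (2 * a)) * (2 * (t * inner ℝ (q - w) (z - q)) + t ^ 2 * ‖z - q‖ ^ 2)) =
        t * (a * (R z - R q) + inner ℝ (q - w) (z - q) + t * (‖z - q‖ ^ 2 / 2)) := by
      field_simp
      ring
    rw [h5] at h4
    exact nonneg_of_mul_nonneg_right h4 ht
  have hlim : Tendsto (fun t : ℝ =>
      a * (R z - R q) + inner ℝ (q - w) (z - q) + t * (‖z - q‖ ^ 2 / 2)) (nhdsWithin 0 (Set.Ioi 0))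
      (nhds (a * (R z - R q) + inner ℝ (q - w) (z - q))) := by
    have hc : Continuous (fun t : ℝ =>
        a * (R z - R q) + inner ℝ (q - w) (z - q) + t * (‖z - q‖ ^ 2 / 2)) := by fun_prop
    simpa using (hc.tendsto 0).mono_left nhdsWithin_le_nhds
  refine ge_of_tendsto hlim ?_
  filter_upwards [Ioo_mem_nhdsGT (zero_lt_one (α := ℝ))] with t ht
  exact key t ht.1 ht.2

/-- The proximal map is nonexpansive. -/
theorem ConvexOn.norm_prox_sub_prox_le {R : E → ℝ} (hR : ConvexOn ℝ Set.univ R)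
    {a : ℝ} (ha : 0 < a) {q₁ q₂ w₁ w₂ : E}
    (h₁ : ∀ z, R q₁ + (1 / (2 * a)) * ‖q₁ - w₁‖ ^ 2 ≤ R z + (1 / (2 * a)) * ‖z - w₁‖ ^ 2)
    (h₂ : ∀ z, R q₂ + (1 / (2 * a)) * ‖q₂ - w₂‖ ^ 2 ≤ R z + (1 / (2 * a)) * ‖z - w₂‖ ^ 2) :
    ‖q₁ - q₂‖ ≤ ‖w₁ - w₂‖ := by
  have v₁ := hR.prox_variational_inequality ha h₁ q₂
  have v₂ := hR.prox_variational_inequality ha h₂ q₁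
  have hinner : inner ℝ (q₁ - w₁) (q₂ - q₁) + inner ℝ (q₂ - w₂) (q₁ - q₂) =
      inner ℝ (w₁ - w₂) (q₁ - q₂) - ‖q₁ - q₂‖ ^ 2 := by
    rw [← real_inner_self_eq_norm_sq, ← neg_sub q₁ q₂, inner_neg_right, neg_add_eq_sub,
      ← inner_sub_left, ← inner_sub_left]
    congr 1
    abel
  have hcs := real_inner_le_norm (w₁ - w₂) (q₁ - q₂)
  by_contra! hlt
  nlinarith [norm_nonneg (w₁ - w₂)]

/-- The descent lemma for a function with Lipschitz continuous gradient. -/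
theorem le_add_inner_gradient_add_of_lipschitz [CompleteSpace E] {f : E → ℝ} {L : ℝ}
    (hf : Differentiable ℝ f) (hlip : ∀ u v, ‖gradient f u - gradient f v‖ ≤ L * ‖u - v‖)
    (x y : E) :
    f y ≤ f x + inner ℝ (gradient f x) (y - x) + L / 2 * ‖y - x‖ ^ 2 := by
  set s := y - x with hs
  have hd : ∀ t : ℝ, HasDerivAt
      (fun t : ℝ => f (x + t • s) - t * inner ℝ (gradient f x) s - L / 2 * ‖s‖ ^ 2 * t ^ 2)
      (inner ℝ (gradient f (x + t • s)) s - inner ℝ (gradient f x) s - L * ‖s‖ ^ 2 * t) t := by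
    intro t
    have hline : HasDerivAt (fun t : ℝ => x + t • s) s t := by
      simpa using ((hasDerivAt_id t).smul_const s).const_add x
    have hcomp := ((hf (x + t • s)).hasGradientAt.hasFDerivAt).comp_hasDerivAt t hline
    rw [InnerProductSpace.toDual_apply_apply] at hcomp
    have hlin := (hasDerivAt_id t).mul_const (inner ℝ (gradient f x) s)
    have hquad := (hasDerivAt_pow 2 t).const_mul (L / 2 * ‖s‖ ^ 2)
    refine ((hcomp.sub hlin).sub hquad).congr_deriv ?_
    push_cast
    ring
  have hanti := antitoneOn_of_deriv_nonpos (convex_Icc (0 : ℝ) 1)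
    (fun t _ => (hd t).continuousAt.continuousWithinAt)
    (fun t _ => (hd t).differentiableAt.differentiableWithinAt)
    (fun t ht => by
      rw [interior_Icc] at ht
      rw [(hd t).deriv, ← inner_sub_left]
      have hl := hlip (x + t • s) x
      rw [add_sub_cancel_left, norm_smul, Real.norm_of_nonneg ht.1.le] at hl
      have hcs := real_inner_le_norm (gradient f (x + t • s) - gradient f x) s
      have hmul := mul_le_mul_of_nonneg_right hl (norm_nonneg s)
      linarith)
  have h := hanti (Set.left_mem_Icc.2 zero_le_one) (Set.right_mem_Icc.2 zero_le_one) zero_le_one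
  have hy : x + s = y := by rw [hs]; abel
  simp only [one_smul, zero_smul, add_zero, hy] at h
  linarith

/-- One inexact forward–backward step bounds the exact proximal-gradient mapping by the decrease
of the objective and the gradient error. -/
theorem prox_gradient_mapping_sq_le [CompleteSpace E] {f R : E → ℝ} {L a : ℝ}
    (hf : Differentiable ℝ f) (hlip : ∀ u v, ‖gradient f u - gradient f v‖ ≤ L * ‖u - v‖)
    (hR : ConvexOn ℝ Set.univ R) (ha : 0 < a) (haL : a * L ≤ 1 / 2) {x y g p : E}
    (hy : ∀ z, R y + (1 / (2 * a)) * ‖y - (x - a • g)‖ ^ 2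
      ≤ R z + (1 / (2 * a)) * ‖z - (x - a • g)‖ ^ 2)
    (hp : ∀ z, R p + (1 / (2 * a)) * ‖p - (x - a • gradient f x)‖ ^ 2
      ≤ R z + (1 / (2 * a)) * ‖z - (x - a • gradient f x)‖ ^ 2) :
    a * ((1 / a ^ 2) * ‖x - p‖ ^ 2) ≤
      8 * ((f x + R x) - (f y + R y)) + 6 * a * ‖gradient f x - g‖ ^ 2 := by
  have hvar := hR.prox_variational_inequality ha hy x
  have hdesc := le_add_inner_gradient_add_of_lipschitz hf hlip x y
  have hnear := hR.norm_prox_sub_prox_le ha hy hp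
  rw [show x - a • g - (x - a • gradient f x) = a • (gradient f x - g) by module, norm_smul,
    Real.norm_of_nonneg ha.le] at hnear
  have hinner : inner ℝ (y - (x - a • g)) (x - y) =
      -‖y - x‖ ^ 2 - a * inner ℝ g (y - x) := by
    rw [show y - (x - a • g) = (y - x) + a • g by module, ← neg_sub y x, inner_neg_right,
      inner_add_left, real_inner_self_eq_norm_sq, real_inner_smul_left]
    ring
  rw [hinner] at hvar
  have hcs := real_inner_le_norm (gradient f x - g) (y - x)
  rw [inner_sub_left] at hcs
  have htri := norm_sub_le_norm_sub_add_norm_sub x y p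
  rw [norm_sub_rev x y] at htri
  set s := ‖y - x‖
  set e := ‖gradient f x - g‖
  have hs : 0 ≤ s := norm_nonneg _
  have he : 0 ≤ e := norm_nonneg _
  have hdec : s ^ 2 ≤ 4 * a * ((f x + R x) - (f y + R y)) + 2 * a ^ 2 * e ^ 2 := by
    have hdesc' := mul_le_mul_of_nonneg_left hdesc ha.le
    have hcs' := mul_le_mul_of_nonneg_left hcs ha.le
    have hL' := mul_le_mul_of_nonneg_right haL (sq_nonneg s)
    nlinarith [sq_nonneg (s - a * e)]
  have hdist : ‖x - p‖ ^ 2 ≤ 2 * s ^ 2 + 2 * a ^ 2 * e ^ 2 := by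
    have hle : ‖x - p‖ ≤ s + a * e := by linarith
    have hsq := pow_le_pow_left₀ (norm_nonneg _) hle 2
    nlinarith [sq_nonneg (s - a * e)]
  rw [show a * ((1 / a ^ 2) * ‖x - p‖ ^ 2) = ‖x - p‖ ^ 2 / a by field_simp, div_le_iff₀ ha]
  nlinarith

end ProximalPoint

/-- Deterministic (pointwise-error) summability bound (A7) for the inexact forward–backward
iteration: `∑ₖ (1/αₖ²)‖xₖ − pₖ‖² ≤ (8(F(x₀) − F_inf) + 6α_max ε̄)/α̃`, in particular the
series converges and `(1/αₖ)‖xₖ − pₖ‖ → 0`. -/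
theorem stmt6 {d : ℕ} (hd : 1 ≤ d)
    (f R : EuclideanSpace ℝ (Fin d) → ℝ) (L : ℝ) (hL : 0 < L)
    (hf : Differentiable ℝ f)
    (hlip : ∀ u v, ‖gradient f u - gradient f v‖ ≤ L * ‖u - v‖)
    (hR : ConvexOn ℝ Set.univ R)
    (Finf : ℝ) (hbdd : ∀ z, Finf ≤ f z + R z)
    (αtil αmax : ℝ) (hαtil : 0 < αtil) (h1 : αtil ≤ αmax) (h2 : αmax ≤ 1 / (2 * L))
    (x g : ℕ → EuclideanSpace ℝ (Fin d)) (α : ℕ → ℝ)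
    (hα : ∀ k, αtil ≤ α k ∧ α k ≤ αmax)
    (hstep : ∀ k, ∀ z,
      R (x (k + 1)) + (1 / (2 * α k)) * ‖x (k + 1) - (x k - α k • g k)‖ ^ 2
        ≤ R z + (1 / (2 * α k)) * ‖z - (x k - α k • g k)‖ ^ 2)
    (ε : ℕ → ℝ) (hε : ∀ k, 0 ≤ ε k)
    (herr : ∀ k, ‖gradient f (x k) - g k‖ ^ 2 ≤ ε k)
    (εbar : ℝ) (hsum : HasSum ε εbar)
    (p : ℕ → EuclideanSpace ℝ (Fin d))
    (hp : ∀ k, ∀ z,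
      R (p k) + (1 / (2 * α k)) * ‖p k - (x k - α k • gradient f (x k))‖ ^ 2
        ≤ R z + (1 / (2 * α k)) * ‖z - (x k - α k • gradient f (x k))‖ ^ 2) :
    Summable (fun k => (1 / (α k) ^ 2) * ‖x k - p k‖ ^ 2) ∧
    (∑' k, (1 / (α k) ^ 2) * ‖x k - p k‖ ^ 2)
        ≤ (8 * (f (x 0) + R (x 0) - Finf) + 6 * αmax * εbar) / αtil ∧
    Tendsto (fun k => (1 / α k) * ‖x k - p k‖) atTop (nhds 0) := by
  have hpos : ∀ k, 0 < α k := fun k => hαtil.trans_le (hα k).1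
  have hterm : ∀ k, 0 ≤ (1 / (α k) ^ 2) * ‖x k - p k‖ ^ 2 := fun k => by positivity
  have hstepBound : ∀ k, αtil * ((1 / (α k) ^ 2) * ‖x k - p k‖ ^ 2) ≤
      8 * ((f (x k) + R (x k)) - (f (x (k + 1)) + R (x (k + 1)))) + 6 * αmax * ε k := by
    intro k
    have haL : α k * L ≤ 1 / 2 := by
      have h := mul_le_mul_of_nonneg_right ((hα k).2.trans h2) hL.le
      rwa [show 1 / (2 * L) * L = 1 / 2 by field_simp] at h
    have hk := prox_gradient_mapping_sq_le hf hlip hR (hpos k) haL (hstep k) (hp k)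
    have hl := mul_le_mul_of_nonneg_right (hα k).1 (hterm k)
    have he : α k * ‖gradient f (x k) - g k‖ ^ 2 ≤ αmax * ε k :=
      mul_le_mul (hα k).2 (herr k) (sq_nonneg _) (hαtil.le.trans h1)
    linarith
  have hpartial : ∀ n, ∑ k ∈ Finset.range n, (1 / (α k) ^ 2) * ‖x k - p k‖ ^ 2 ≤
      (8 * (f (x 0) + R (x 0) - Finf) + 6 * αmax * εbar) / αtil := by
    intro n
    have hsumle := Finset.sum_le_sum fun k (_ : k ∈ Finset.range n) => hstepBound k
    rw [← Finset.mul_sum, Finset.sum_add_distrib, ← Finset.mul_sum, ← Finset.mul_sum,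
      Finset.sum_range_sub' (fun k => f (x k) + R (x k))] at hsumle
    have heps := mul_le_mul_of_nonneg_left (sum_le_hasSum (Finset.range n) (fun k _ => hε k) hsum)
      (by linarith : 0 ≤ 6 * αmax)
    rw [le_div_iff₀ hαtil]
    linarith [hbdd (x n)]
  have hsummable := summable_of_sum_range_le hterm hpartial
  refine ⟨hsummable, Real.tsum_le_of_sum_range_le hterm hpartial, ?_⟩
  have hsqrt := hsummable.tendsto_atTop_zero.sqrt
  rw [Real.sqrt_zero] at hsqrt
  refine hsqrt.congr fun k => ?_
  have := hpos k
  rw [show (1 / (α k) ^ 2) * ‖x k - p k‖ ^ 2 = ((1 / α k) * ‖x k - p k‖) ^ 2 by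
    rw [mul_pow, div_pow, one_pow], Real.sqrt_sq (by positivity)]
end
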